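/- arXiv:1809.05083 — 4 statements merged into one kernel-verified Lean document; each statement's English description precedes it below -/
import Mathlib

section
/- Let R be a set of rewrite rules on binary trees such that for every rule (s, s') in R the prefix word of s is strictly greater than the prefix word of s' in the lexicographic order (s and s' having the same arity). Then the rewrite relation induced by R is terminating, i.e. there is no infinite sequence t_0 ⇒ t_1 ⇒ t_2 ⇒ ⋯. -/
/-- A binary tree: either a leaf or an ordered pair of binary trees. -/
inductive BTree : Type
  | leaf : BTree
  | node : BTree → BTree → BTree
  deriving DecidableEq

namespace BTree

/-- The arity of a binary tree is its number of leaves. -/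
def arity : BTree → ℕ
  | leaf => 1
  | node l r => arity l + arity r

/-- The degree of a binary tree is its number of internal nodes. -/
def degree : BTree → ℕ
  | leaf => 0
  | node l r => degree l + degree r + 1

/-- Grafting `t ∘ᵢ s`: identify the root of `s` with the `i`-th leaf of `t`
(leaves numbered from left to right, starting at `1`). -/
def graft : BTree → ℕ → BTree → BTree
  | leaf, i, s => if i = 1 then s else leaf
  | node l r, i, s =>
      if i ≤ l.arity then node (l.graft i s) r else node l (r.graft (i - l.arity) s)

/-- Simultaneous grafting `s ∘ [r_1, …, r_n]`: graft the `i`-th element of the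
list onto the `i`-th leaf of `s`, simultaneously. -/
def multigraft : BTree → List BTree → BTree
  | leaf, rs => rs.headD leaf
  | node l r, rs => node (l.multigraft (rs.take l.arity)) (r.multigraft (rs.drop l.arity))

/-- The left comb with `γ` internal nodes. -/
def leftComb : ℕ → BTree
  | 0 => leaf
  | γ + 1 => node (leftComb γ) leaf

/-- The right comb with `γ` internal nodes. -/
def rightComb : ℕ → BTree
  | 0 => leaf
  | γ + 1 => node leaf (rightComb γ)

/-- The prefix word of a binary tree, over the alphabet `{0, 2}`:
a left-to-right depth-first traversal writes `2` for each internal node and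
`0` for each leaf. -/
def prefixWord : BTree → List ℕ
  | leaf => [0]
  | node l r => 2 :: (prefixWord l ++ prefixWord r)

/-- The left rank: number of internal nodes on the leftmost branch from the root. -/
def leftRank : BTree → ℕ
  | leaf => 0
  | node l _ => leftRank l + 1

/-- The mirror of a binary tree. -/
def mirror : BTree → BTree
  | leaf => leaf
  | node l r => node (mirror r) (mirror l)

end BTree

/-- One step of the rewrite relation induced by a set of rewrite rules `R`:
`r ∘ᵢ (s ∘ [r_1, …, r_n]) ⇒ r ∘ᵢ (s' ∘ [r_1, …, r_n])` whenever `R s s'`. -/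
def Step (R : BTree → BTree → Prop) (t t' : BTree) : Prop :=
  ∃ (s s' r : BTree) (i : ℕ) (rs : List BTree),
    R s s' ∧ 1 ≤ i ∧ i ≤ r.arity ∧ rs.length = s.arity ∧
    t = r.graft i (s.multigraft rs) ∧ t' = r.graft i (s'.multigraft rs)

/-- The congruence generated by a set of rewrite rules: the reflexive–symmetric–transitive
closure of the induced rewrite relation. -/
def CongrGen (R : BTree → BTree → Prop) : BTree → BTree → Prop :=
  Relation.EqvGen (Step R)

/-- The tree `s` occurs as a subtree of `t`. -/
def Occurs (s t : BTree) : Prop :=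
  ∃ (r : BTree) (i : ℕ) (rs : List BTree),
    1 ≤ i ∧ i ≤ r.arity ∧ rs.length = s.arity ∧ t = r.graft i (s.multigraft rs)

/-- The rewrite relation induced by `R` is terminating: there is no infinite
chain `t_0 ⇒ t_1 ⇒ t_2 ⇒ ⋯`. -/
def Terminating (R : BTree → BTree → Prop) : Prop :=
  ¬ ∃ f : ℕ → BTree, ∀ n, Step R (f n) (f (n + 1))

/-- The rewrite relation induced by `R` is confluent. -/
def Confluent (R : BTree → BTree → Prop) : Prop :=
  ∀ t s₁ s₂, Relation.ReflTransGen (Step R) t s₁ → Relation.ReflTransGen (Step R) t s₂ →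
    ∃ t', Relation.ReflTransGen (Step R) s₁ t' ∧ Relation.ReflTransGen (Step R) s₂ t'

/-- The number of equivalence classes of binary trees of arity `n` under the
equivalence relation `E`. -/
noncomputable def classCount (E : BTree → BTree → Prop) (n : ℕ) : ℕ :=
  Nat.card (Quot fun a b : {t : BTree // t.arity = n} => E a.1 b.1)

/-- The congruence `≡_γ` generated by the single rewrite rule `(L_γ, R_γ)`. -/
def CAsCongr (γ : ℕ) : BTree → BTree → Prop :=
  CongrGen fun s s' => s = BTree.leftComb γ ∧ s' = BTree.rightComb γ

namespace BTree

theorem length_prefixWord (t : BTree) : t.prefixWord.length + 1 = 2 * t.arity := by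
  induction t with
  | leaf => rfl
  | node l r ihl ihr => simp only [prefixWord, arity, List.length_cons, List.length_append]; omega

theorem eq_zero_or_two_of_mem_prefixWord {t : BTree} {x : ℕ} (hx : x ∈ t.prefixWord) :
    x = 0 ∨ x = 2 := by
  induction t with
  | leaf => simp_all [prefixWord]
  | node l r ihl ihr =>
    simp only [prefixWord, List.mem_cons, List.mem_append] at hx
    tauto

theorem getLast?_prefixWord (t : BTree) : t.prefixWord.getLast? = some 0 := by
  induction t with
  | leaf => rfl
  | node l r ihl ihr => simp [prefixWord, List.getLast?_cons, List.getLast?_append, ihr]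

/-- The word obtained from `w` by replacing successive letters `0` by the prefix words of the
trees in a list, where missing trees count as leaves. -/
def substWord : List ℕ → List BTree → List ℕ
  | [], _ => []
  | 0 :: w, rs => (rs.headD leaf).prefixWord ++ substWord w rs.tail
  | (a + 1) :: w, rs => (a + 1) :: substWord w rs

theorem multigraft_take_arity (s : BTree) (rs : List BTree) :
    s.multigraft (rs.take s.arity) = s.multigraft rs := by
  induction s generalizing rs with
  | leaf => cases rs <;> rfl
  | node l r ihl ihr =>
    simp only [multigraft, arity, List.take_take, List.drop_take]
    rw [Nat.min_eq_left (Nat.le_add_right _ _), Nat.add_sub_cancel_left, ihr]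

theorem substWord_prefixWord_append (s : BTree) (w : List ℕ) (rs : List BTree) :
    substWord (s.prefixWord ++ w) rs =
      (s.multigraft rs).prefixWord ++ substWord w (rs.drop s.arity) := by
  induction s generalizing w rs with
  | leaf => simp [prefixWord, substWord, multigraft, arity]
  | node l r ihl ihr =>
    simp [prefixWord, substWord, multigraft, arity, ihl, ihr, multigraft_take_arity]

theorem substWord_prefixWord (s : BTree) (rs : List BTree) :
    substWord s.prefixWord rs = (s.multigraft rs).prefixWord := by
  simpa [substWord] using substWord_prefixWord_append s [] rs

theorem arity_multigraft {s : BTree} {rs : List BTree} (h : rs.length = s.arity) :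
    (s.multigraft rs).arity = (rs.map arity).sum := by
  induction s generalizing rs with
  | leaf =>
    obtain ⟨r, rfl⟩ := List.length_eq_one_iff.1 h
    simp [multigraft]
  | node l r ihl ihr =>
    simp only [arity] at h
    rw [multigraft, arity, ihl (by simp [h]), ihr (by simp [h]), ← List.sum_append,
      ← List.map_append, List.take_append_drop]

theorem lex_prefixWord_replicate (r : BTree) (m : ℕ) (x y : List ℕ) :
    List.Lex (· < ·) (r.prefixWord ++ x)
      (List.replicate (m + 1) 2 ++ (r.prefixWord ++ y)) := by
  induction r generalizing m x y with
  | leaf => exact .rel (by decide)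
  | node l r ihl _ =>
    have := ihl m (r.prefixWord ++ x) (r.prefixWord ++ y)
    rw [List.replicate_succ'] at this
    simpa [prefixWord, List.replicate_succ] using List.Lex.cons (a := 2) this

theorem substWord_replicate_append (m : ℕ) (w : List ℕ) (rs : List BTree) :
    substWord (List.replicate m 2 ++ w) rs = List.replicate m 2 ++ substWord w rs := by
  induction m with
  | zero => rfl
  | succ m ih => simp [List.replicate_succ, substWord, ih]

theorem exists_eq_replicate_append {w : List ℕ} (hw : ∀ x ∈ w, x = 0 ∨ x = 2)
    (h0 : 0 ∈ w) : ∃ m v, w = List.replicate m 2 ++ 0 :: v := by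
  induction w with
  | nil => simp at h0
  | cons a w ih =>
    rcases hw a (by simp) with rfl | rfl
    · exact ⟨0, w, rfl⟩
    · obtain ⟨m, v, rfl⟩ := ih (fun x hx => hw x (by simp [hx])) (by simpa using h0)
      exact ⟨m + 1, v, rfl⟩

theorem lex_append_left (u : List ℕ) {v w : List ℕ} (h : List.Lex (· < ·) v w) :
    List.Lex (· < ·) (u ++ v) (u ++ w) := by
  induction u with
  | nil => exact h
  | cons a u ih => exact .cons ih

theorem lex_append_right {v w : List ℕ} (h : List.Lex (· < ·) v w)
    (hlen : v.length = w.length) (x y : List ℕ) :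
    List.Lex (· < ·) (v ++ x) (w ++ y) := by
  induction h with
  | nil => simp at hlen
  | rel h => exact .rel h
  | cons _ ih => exact .cons (ih (by simpa using hlen))

theorem lex_substWord {v w : List ℕ} (h : List.Lex (· < ·) v w)
    (hlen : v.length = w.length) (hv : ∀ x ∈ v, x = 0 ∨ x = 2)
    (hw : ∀ x ∈ w, x = 0 ∨ x = 2) (hlast : w.getLast? = some 0) (rs : List BTree) :
    List.Lex (· < ·) (substWord v rs) (substWord w rs) := by
  induction h generalizing rs with
  | nil => simp at hlen
  | @rel a v b w hab =>
    have ha : a = 0 := by have := hv a (by simp); have := hw b (by simp); omega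
    have hb : b = 2 := by have := hw b (by simp); omega
    subst ha hb
    have h0 : 0 ∈ w := by simpa using List.mem_of_getLast? hlast
    obtain ⟨m, u, rfl⟩ := exists_eq_replicate_append (fun x hx => hw x (by simp [hx])) h0
    rw [← List.cons_append, ← List.replicate_succ, substWord_replicate_append]
    exact lex_prefixWord_replicate _ _ _ _
  | @cons a v w h ih =>
    have hne : w ≠ [] := by rintro rfl; cases h
    have key := ih (by simpa using hlen) (fun x hx => hv x (by simp [hx]))
      (fun x hx => hw x (by simp [hx]))
      (by obtain ⟨b, w, rfl⟩ := List.exists_cons_of_ne_nil hne; simpa using hlast)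
    rcases hv a (by simp) with rfl | rfl
    · exact lex_append_left _ (key _)
    · exact .cons (key _)

theorem exists_prefixWord_graft {r : BTree} {i : ℕ} (h1 : 1 ≤ i) (hi : i ≤ r.arity) :
    ∃ u v, ∀ s : BTree, (r.graft i s).prefixWord = u ++ (s.prefixWord ++ v) := by
  induction r generalizing i with
  | leaf =>
    obtain rfl : i = 1 := le_antisymm hi h1
    exact ⟨[], [], fun s => by simp [graft]⟩
  | node l r ihl ihr =>
    simp only [arity] at hi
    by_cases hl : i ≤ l.arity
    · obtain ⟨u, v, h⟩ := ihl h1 hl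
      exact ⟨2 :: u, v ++ r.prefixWord, fun s => by simp [graft, hl, prefixWord, h]⟩
    · obtain ⟨u, v, h⟩ := ihr (i := i - l.arity) (by omega) (by omega)
      exact ⟨2 :: (l.prefixWord ++ u), v, fun s => by simp [graft, hl, prefixWord, h]⟩

theorem ofDigits_reverse_lt_of_lex {v w : List ℕ} (h : List.Lex (· < ·) v w)
    (hlen : v.length = w.length) (hv : ∀ x ∈ v, x < 3) :
    Nat.ofDigits 3 v.reverse < Nat.ofDigits 3 w.reverse := by
  induction h with
  | nil => simp at hlen
  | @rel a v b w hab =>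
    have hlt : Nat.ofDigits 3 v.reverse < 3 ^ v.reverse.length :=
      Nat.ofDigits_lt_base_pow_length (by decide) fun x hx =>
        hv x (by simp [List.mem_reverse.1 hx])
    have hlen' : v.length = w.length := by simpa using hlen
    simp only [List.reverse_cons, Nat.ofDigits_append, Nat.ofDigits_singleton,
      List.length_reverse, hlen'] at hlt ⊢
    have := Nat.mul_le_mul_left (3 ^ w.length) (Nat.succ_le_of_lt hab)
    rw [Nat.succ_eq_add_one, Nat.mul_succ] at this
    omega
  | @cons a v w _ ih =>
    have hlen' : v.length = w.length := by simpa using hlen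
    have := ih hlen' fun x hx => hv x (by simp [hx])
    simpa [Nat.ofDigits_append, hlen'] using this

theorem lex_prefixWord_of_step {R : BTree → BTree → Prop}
    (h : ∀ s s', R s s' → s.arity = s'.arity ∧
      List.Lex (· < ·) s'.prefixWord s.prefixWord) {t t' : BTree} (ht : Step R t t') :
    t'.prefixWord.length = t.prefixWord.length ∧
      List.Lex (· < ·) t'.prefixWord t.prefixWord := by
  obtain ⟨s, s', r, i, rs, hs, h1, hi, hrs, rfl, rfl⟩ := ht
  obtain ⟨har, hlex⟩ := h s s' hs
  obtain ⟨u, v, huv⟩ := exists_prefixWord_graft h1 hi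
  have hlen : s'.prefixWord.length = s.prefixWord.length := by
    have := length_prefixWord s; have := length_prefixWord s'; omega
  have hlen' : (s'.multigraft rs).prefixWord.length = (s.multigraft rs).prefixWord.length := by
    have := length_prefixWord (s.multigraft rs)
    have := length_prefixWord (s'.multigraft rs)
    rw [arity_multigraft hrs] at *
    rw [arity_multigraft (hrs.trans har)] at *
    omega
  have hsub := lex_substWord hlex hlen (fun _ => eq_zero_or_two_of_mem_prefixWord)
    (fun _ => eq_zero_or_two_of_mem_prefixWord) (getLast?_prefixWord s) rs
  rw [substWord_prefixWord, substWord_prefixWord] at hsub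
  rw [huv, huv]
  exact ⟨by simp [hlen'], lex_append_left _ (lex_append_right hsub hlen' _ _)⟩

end BTree

/-- If every rewrite rule strictly decreases the prefix word in the
lexicographic order (induced by `0 < 2`), then the induced rewrite relation
is terminating. -/
theorem stmt0 (R : BTree → BTree → Prop)
    (h : ∀ s s', R s s' → s.arity = s'.arity ∧
      List.Lex (· < ·) s'.prefixWord s.prefixWord) :
    Terminating R := by
  rintro ⟨f, hf⟩
  refine (RelEmbedding.natGT (r := (· < ·))
    (fun n => Nat.ofDigits 3 (f n).prefixWord.reverse) fun n => ?_).not_wellFounded wellFounded_lt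
  obtain ⟨hlen, hlex⟩ := BTree.lex_prefixWord_of_step h (hf n)
  refine BTree.ofDigits_reverse_lt_of_lex hlex hlen fun x hx => ?_
  rcases BTree.eq_zero_or_two_of_mem_prefixWord hx with rfl | rfl <;> decide
end

section
/- Let γ ≥ 2 and 1 ≤ n ≤ γ + 1. The number of ≡_γ-equivalence classes of binary trees of arity n equals catalan(n − 1) if n ≤ γ, and equals catalan(n − 1) − 1 if n = γ + 1. -/
namespace BTree

theorem arity_eq_degree_add_one (t : BTree) : t.arity = t.degree + 1 := by
  induction t with
  | leaf => rfl
  | node l r hl hr => simp only [arity, degree]; omega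

theorem degree_leftComb (γ : ℕ) : (leftComb γ).degree = γ := by
  induction γ with
  | zero => rfl
  | succ γ ih => simp [leftComb, degree, ih]

theorem degree_rightComb (γ : ℕ) : (rightComb γ).degree = γ := by
  induction γ with
  | zero => rfl
  | succ γ ih => simp [rightComb, degree, ih]

theorem leftComb_ne_rightComb {γ : ℕ} (hγ : 2 ≤ γ) : leftComb γ ≠ rightComb γ := by
  obtain ⟨k, rfl⟩ := Nat.exists_eq_add_of_le' hγ
  simp [leftComb, rightComb]

theorem degree_graft (t s : BTree) {i : ℕ} (hi : 1 ≤ i) (hit : i ≤ t.arity) :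
    (t.graft i s).degree = t.degree + s.degree := by
  induction t generalizing i with
  | leaf =>
    obtain rfl : i = 1 := le_antisymm hit hi
    simp [graft, degree]
  | node l r hl hr =>
    simp only [arity] at hit
    by_cases h : i ≤ l.arity
    · simp only [graft, h, if_true, degree, hl hi h]
      omega
    · simp only [graft, h, if_false, degree, hr (i := i - l.arity) (by omega) (by omega)]
      omega

theorem eq_leaf_of_degree_eq_zero {t : BTree} (h : t.degree = 0) : t = leaf := by
  cases t with
  | leaf => rfl
  | node l r => simp [degree] at h

theorem graft_leaf_one (s : BTree) : leaf.graft 1 s = s := by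
  simp [graft]

theorem degree_multigraft (s : BTree) {rs : List BTree} (h : rs.length = s.arity) :
    (s.multigraft rs).degree = s.degree + (rs.map degree).sum := by
  induction s generalizing rs with
  | leaf =>
    obtain ⟨r, rfl⟩ := List.length_eq_one_iff.mp h
    simp [multigraft, degree]
  | node l r hl hr =>
    simp only [arity] at h
    have key : (rs.map degree).sum =
        ((rs.take l.arity).map degree).sum + ((rs.drop l.arity).map degree).sum := by
      rw [← List.sum_append, ← List.map_append, List.take_append_drop]
    simp only [multigraft, degree, key,
      hl (rs := rs.take l.arity) (by simp [h]), hr (rs := rs.drop l.arity) (by simp [h])]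
    omega

theorem multigraft_eq_self (s : BTree) {rs : List BTree} (h : ∀ r ∈ rs, r = leaf) :
    s.multigraft rs = s := by
  induction s generalizing rs with
  | leaf => cases rs <;> simp_all [multigraft]
  | node l r hl hr =>
    rw [multigraft, hl fun x hx => h x (List.mem_of_mem_take hx),
      hr fun x hx => h x (List.mem_of_mem_drop hx)]

/-- Binary trees are the trees of Mathlib without labels on the internal nodes. -/
def toBinaryTree : BTree → BinaryTree Unit
  | leaf => .nil
  | node l r => .node () l.toBinaryTree r.toBinaryTree

/-- The inverse of `BTree.toBinaryTree`. -/
def ofBinaryTree : BinaryTree Unit → BTree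
  | .nil => leaf
  | .node _ l r => node (ofBinaryTree l) (ofBinaryTree r)

/-- The bijection between `BTree` and the unlabelled binary trees of Mathlib. -/
def equivBinaryTree : BTree ≃ BinaryTree Unit where
  toFun := toBinaryTree
  invFun := ofBinaryTree
  left_inv t := by induction t <;> simp_all [toBinaryTree, ofBinaryTree]
  right_inv t := by induction t <;> simp_all [toBinaryTree, ofBinaryTree]

theorem numNodes_equivBinaryTree (t : BTree) : (equivBinaryTree t).numNodes = t.degree := by
  change t.toBinaryTree.numNodes = t.degree
  induction t <;> simp_all [toBinaryTree, degree]

theorem ncard_setOf_degree_eq (m : ℕ) : {t : BTree | t.degree = m}.ncard = catalan m := by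
  rw [← BinaryTree.treesOfNumNodesEq_card_eq_catalan, ← Set.ncard_coe_finset,
    ← Set.ncard_image_of_injective _ equivBinaryTree.injective]
  congr 1
  ext x
  simp [Equiv.image_eq_preimage_symm, ← numNodes_equivBinaryTree]

theorem ncard_setOf_arity_eq {n : ℕ} (hn : 1 ≤ n) :
    {t : BTree | t.arity = n}.ncard = catalan (n - 1) := by
  rw [← ncard_setOf_degree_eq]
  congr 1
  ext t
  simp only [Set.mem_ofPred_eq, arity_eq_degree_add_one]
  omega

/-- Replace the left comb of degree `γ` by the right comb, and fix all the other trees. -/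
def combNormalForm (γ : ℕ) (t : BTree) : BTree :=
  if t = leftComb γ then rightComb γ else t

theorem arity_combNormalForm (γ : ℕ) (t : BTree) : (combNormalForm γ t).arity = t.arity := by
  unfold combNormalForm
  split_ifs with h
  · simp [h, arity_eq_degree_add_one, degree_leftComb, degree_rightComb]
  · rfl

end BTree

section

open BTree

variable {γ : ℕ} {t t' : BTree}

theorem Step.degree_eq
    (h : Step (fun s s' => s = leftComb γ ∧ s' = rightComb γ) t t') :
    t.degree = t'.degree := by
  obtain ⟨s, s', r, i, rs, ⟨rfl, rfl⟩, hi, hir, hrs, rfl, rfl⟩ := h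
  have hrs' : rs.length = (rightComb γ).arity := by
    rw [hrs, arity_eq_degree_add_one, arity_eq_degree_add_one, degree_leftComb, degree_rightComb]
  rw [degree_graft _ _ hi hir, degree_graft _ _ hi hir, degree_multigraft _ hrs,
    degree_multigraft _ hrs', degree_leftComb, degree_rightComb]

theorem Step.eq_combs (h : Step (fun s s' => s = leftComb γ ∧ s' = rightComb γ) t t')
    (ht : t.degree ≤ γ) : t = leftComb γ ∧ t' = rightComb γ := by
  obtain ⟨s, s', r, i, rs, ⟨rfl, rfl⟩, hi, hir, hrs, rfl, rfl⟩ := h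
  rw [degree_graft _ _ hi hir, degree_multigraft _ hrs, degree_leftComb] at ht
  obtain rfl := eq_leaf_of_degree_eq_zero (show r.degree = 0 by omega)
  obtain rfl : i = 1 := le_antisymm hir hi
  have hleaf : ∀ r ∈ rs, r = leaf := fun r hr => eq_leaf_of_degree_eq_zero <|
    List.sum_eq_zero_iff.mp (show (rs.map degree).sum = 0 by omega) _ (List.mem_map_of_mem hr)
  simp only [graft_leaf_one, multigraft_eq_self _ hleaf, and_self]

theorem step_combs (γ : ℕ) :
    Step (fun s s' => s = leftComb γ ∧ s' = rightComb γ) (leftComb γ) (rightComb γ) := by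
  refine ⟨_, _, leaf, 1, List.replicate (leftComb γ).arity leaf, ⟨rfl, rfl⟩, le_rfl, le_rfl,
    by simp, ?_, ?_⟩ <;>
  rw [graft_leaf_one, multigraft_eq_self _ fun r hr => List.eq_of_mem_replicate hr]

theorem CAsCongr.degree_eq_and_combNormalForm_eq (h : CAsCongr γ t t') :
    t.degree = t'.degree ∧ (t.degree ≤ γ → combNormalForm γ t = combNormalForm γ t') := by
  induction h with
  | rel x y h =>
    refine ⟨h.degree_eq, fun hx => ?_⟩
    obtain ⟨rfl, rfl⟩ := h.eq_combs hx
    simp [combNormalForm]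
  | refl x => exact ⟨rfl, fun _ => rfl⟩
  | symm x y _ ih => exact ⟨ih.1.symm, fun hy => (ih.2 (ih.1 ▸ hy)).symm⟩
  | trans x y z _ _ hxy hyz =>
    exact ⟨hxy.1.trans hyz.1, fun hx => (hxy.2 hx).trans (hyz.2 (hxy.1 ▸ hx))⟩

theorem cAsCongr_combNormalForm (γ : ℕ) (t : BTree) : CAsCongr γ t (combNormalForm γ t) := by
  unfold combNormalForm
  split_ifs with h
  · rw [h]
    exact .rel _ _ (step_combs γ)
  · exact .refl _

theorem cAsCongr_iff_combNormalForm_eq (ht : t.degree ≤ γ) :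
    CAsCongr γ t t' ↔ combNormalForm γ t = combNormalForm γ t' := by
  refine ⟨fun h => h.degree_eq_and_combNormalForm_eq.2 ht, fun h => ?_⟩
  exact .trans _ _ _ (cAsCongr_combNormalForm γ t) (h ▸ .symm _ _ (cAsCongr_combNormalForm γ t'))

theorem classCount_cAsCongr_eq_ncard {n : ℕ} (hγ : 2 ≤ γ) (hnγ : n ≤ γ + 1) :
    classCount (CAsCongr γ) n = ({t : BTree | t.arity = n} \ {leftComb γ}).ncard := by
  have hiff (a b : {t : BTree // t.arity = n}) :
      CAsCongr γ a.1 b.1 ↔ combNormalForm γ a.1 = combNormalForm γ b.1 := by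
    refine cAsCongr_iff_combNormalForm_eq ?_
    have := a.2
    rw [arity_eq_degree_add_one] at this
    omega
  have hne (t : BTree) : combNormalForm γ t ≠ leftComb γ := by
    unfold combNormalForm
    split_ifs with h
    · exact (leftComb_ne_rightComb hγ).symm
    · exact h
  let f : (Quot fun a b : {t : BTree // t.arity = n} => CAsCongr γ a.1 b.1) →
      ↥({t : BTree | t.arity = n} \ {leftComb γ}) :=
    Quot.lift (fun a => ⟨combNormalForm γ a.1, (arity_combNormalForm γ a.1).trans a.2, hne a.1⟩)
      fun a b h => Subtype.ext ((hiff a b).mp h)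
  rw [← Nat.card_coe_set_eq, classCount]
  refine Nat.card_eq_of_bijective f ⟨?_, ?_⟩
  · rintro ⟨a⟩ ⟨b⟩ h
    exact Quot.sound ((hiff a b).mpr (congrArg Subtype.val h))
  · rintro ⟨t, ht, htL⟩
    exact ⟨Quot.mk _ ⟨t, ht⟩, Subtype.ext (if_neg htL)⟩

end

/-- First dimensions of the `γ`-comb associative operad: for `2 ≤ γ` and
`1 ≤ n ≤ γ + 1`, the number of `≡_γ`-classes of binary trees of arity `n` is
`catalan (n - 1)` minus `1` exactly when `n = γ + 1`. -/
theorem stmt4 (γ n : ℕ) (hγ : 2 ≤ γ) (hn : 1 ≤ n) (hnγ : n ≤ γ + 1) :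
    classCount (CAsCongr γ) n = catalan (n - 1) - (if n = γ + 1 then 1 else 0) := by
  rw [classCount_cAsCongr_eq_ncard hγ hnγ, ← BTree.ncard_setOf_arity_eq hn]
  have hmem : BTree.leftComb γ ∈ {t : BTree | t.arity = n} ↔ n = γ + 1 := by
    rw [Set.mem_ofPred_eq, BTree.arity_eq_degree_add_one, BTree.degree_leftComb, eq_comm]
  split_ifs with h
  · exact Set.ncard_sdiff_singleton_of_mem (hmem.mpr h)
  · rw [Set.sdiff_singleton_eq_self (mt hmem.mp h), Nat.sub_zero]
end

section
/- Let γ ≥ 2 be an integer and let t and t' be binary trees with t ≡_γ t'. Then lr(t) ≡ lr(t') (mod γ − 1), where lr(u) denotes the left rank of u, i.e. the number of internal nodes on the leftmost branch starting at the root of u. -/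
namespace BTree

theorem arity_pos (t : BTree) : 0 < t.arity := by
  induction t with
  | leaf => simp [arity]
  | node l r hl hr => simp only [arity]; omega

theorem leftRank_multigraft (s : BTree) (rs : List BTree) :
    (s.multigraft rs).leftRank = s.leftRank + (rs.headD leaf).leftRank := by
  induction s generalizing rs with
  | leaf => simp [multigraft, leftRank]
  | node l r hl hr =>
    obtain ⟨k, hk⟩ := Nat.exists_eq_add_one.2 l.arity_pos
    have hhead : (rs.take l.arity).headD leaf = rs.headD leaf := by
      cases rs <;> simp [hk]
    simp only [multigraft, leftRank, hl, hhead]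
    omega

theorem leftRank_leftComb (γ : ℕ) : (leftComb γ).leftRank = γ := by
  induction γ with
  | zero => rfl
  | succ γ ih => simp [leftComb, leftRank, ih]

theorem leftRank_rightComb_succ (γ : ℕ) : (rightComb (γ + 1)).leftRank = 1 := rfl

theorem leftRank_graft_modEq {m : ℕ} {u v : BTree} (h : u.leftRank ≡ v.leftRank [MOD m])
    (r : BTree) (i : ℕ) : (r.graft i u).leftRank ≡ (r.graft i v).leftRank [MOD m] := by
  induction r generalizing i with
  | leaf =>
    simp only [graft]
    split_ifs
    · exact h
    · rfl
  | node l r hl hr =>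
    simp only [graft]
    split_ifs
    · exact (hl i).add_right 1
    · rfl

end BTree

/-- `≡_γ`-equivalent binary trees have congruent left ranks modulo `γ - 1`. -/
theorem stmt5 (γ : ℕ) (hγ : 2 ≤ γ) (t t' : BTree) (h : CAsCongr γ t t') :
    t.leftRank % (γ - 1) = t'.leftRank % (γ - 1) := by
  induction h with
  | rel t t' h =>
    obtain ⟨_, _, r, i, rs, ⟨rfl, rfl⟩, -, -, -, rfl, rfl⟩ := h
    refine BTree.leftRank_graft_modEq ?_ r i
    obtain ⟨k, rfl⟩ := Nat.exists_eq_add_of_le' (one_le_two.trans hγ)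
    rw [BTree.leftRank_multigraft, BTree.leftRank_multigraft, BTree.leftRank_leftComb,
      BTree.leftRank_rightComb_succ, Nat.add_sub_cancel]
    exact Nat.ModEq.add_right _ (by simp [Nat.ModEq])
  | refl => rfl
  | symm _ _ _ ih => exact ih.symm
  | trans _ _ _ _ _ ih₁ ih₂ => exact ih₁.trans ih₂
end

section
/- Let γ ≥ 2 and let ≈ be the congruence generated by the set of rewrite rules {(t, R_γ) : t a binary tree of arity γ + 1}. Then: (i) for n ≤ γ, any two ≈-equivalent binary trees of arity n are equal; (ii) for n ≥ γ + 1, any two binary trees of arity n are ≈-equivalent. Consequently the number of ≈-equivalence classes of binary trees of arity n is catalan(n − 1) for n ≤ γ and 1 for n ≥ γ + 1, so the quotient of the magmatic operad by ≈ is realized by the γ-right comb operad RC_γ. -/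
/-- The congruence generated by the rules `(t, R_γ)`, `t` of arity `γ + 1`. -/
def RCCongr (γ : ℕ) : BTree → BTree → Prop :=
  CongrGen fun s s' => s.arity = γ + 1 ∧ s' = BTree.rightComb γ

namespace BTree

theorem one_le_arity (t : BTree) : 1 ≤ t.arity := by
  induction t with
  | leaf => simp [arity]
  | node l r hl hr => simp only [arity]; omega

theorem arity_rightComb (γ : ℕ) : (rightComb γ).arity = γ + 1 := by
  induction γ with
  | zero => rfl
  | succ γ ih => simp only [rightComb, arity, ih]; omega

theorem arity_le_arity_multigraft (s : BTree) (rs : List BTree) :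
    s.arity ≤ (s.multigraft rs).arity := by
  induction s generalizing rs with
  | leaf => exact one_le_arity _
  | node l r hl hr => exact Nat.add_le_add (hl _) (hr _)

theorem arity_le_arity_graft (r s : BTree) {i : ℕ} (hi : 1 ≤ i) (hr : i ≤ r.arity) :
    s.arity ≤ (r.graft i s).arity := by
  induction r generalizing i with
  | leaf =>
    obtain rfl : i = 1 := le_antisymm hr hi
    simp [graft]
  | node l r ihl ihr =>
    simp only [arity] at hr
    by_cases h : i ≤ l.arity
    · simpa [graft, h, arity] using (ihl hi h).trans (Nat.le_add_right _ _)
    · simpa [graft, h, arity] using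
        (ihr (i := i - l.arity) (by omega) (by omega)).trans (Nat.le_add_left _ _)

theorem node_multigraft_append (s₁ s₂ : BTree) (rs₁ rs₂ : List BTree)
    (h : rs₁.length = s₁.arity) :
    (node s₁ s₂).multigraft (rs₁ ++ rs₂) = node (s₁.multigraft rs₁) (s₂.multigraft rs₂) := by
  simp [multigraft, ← h]

/-- Every tree has a prefix of each arity up to its own. -/
theorem exists_eq_multigraft (t : BTree) {k : ℕ} (hk : 1 ≤ k) (hkt : k ≤ t.arity) :
    ∃ (s : BTree) (rs : List BTree),
      s.arity = k ∧ rs.length = s.arity ∧ t = s.multigraft rs := by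
  induction t generalizing k with
  | leaf => exact ⟨leaf, [leaf], le_antisymm hk hkt, rfl, rfl⟩
  | node l r ihl ihr =>
    obtain rfl | hk' := hk.eq_or_lt
    · exact ⟨leaf, [node l r], rfl, rfl, rfl⟩
    simp only [arity] at hkt
    have hl := one_le_arity l
    have hr := one_le_arity r
    obtain ⟨s₁, rs₁, h₁, hl₁, e₁⟩ :=
      ihl (k := min l.arity (k - 1)) (by omega) (by omega)
    obtain ⟨s₂, rs₂, h₂, hl₂, e₂⟩ :=
      ihr (k := k - min l.arity (k - 1)) (by omega) (by omega)
    refine ⟨node s₁ s₂, rs₁ ++ rs₂, ?_, by simp [arity, hl₁, hl₂], ?_⟩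
    · simp only [arity]; omega
    · rw [node_multigraft_append _ _ _ _ hl₁, ← e₁, ← e₂]

theorem multigraft_replicate_leaf (t : BTree) :
    t.multigraft (List.replicate t.arity leaf) = t := by
  induction t with
  | leaf => rfl
  | node l r hl hr =>
    rw [arity, List.replicate_add, node_multigraft_append _ _ _ _ List.length_replicate, hl, hr]

/-- Binary trees are Mathlib's trees with trivially labelled nodes. -/
def equivTree : BTree ≃ BinaryTree Unit where
  toFun := toBinaryTree
  invFun := ofBinaryTree
  left_inv t := by
    induction t with
    | leaf => rfl
    | node l r hl hr => exact congrArg₂ node hl hr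
  right_inv t := by
    induction t with
    | nil => rfl
    | node a l r hl hr => exact congrArg₂ (BinaryTree.node ()) hl hr

theorem numNodes_equivTree (t : BTree) : (equivTree t).numNodes + 1 = t.arity := by
  induction t with
  | leaf => rfl
  | node l r hl hr =>
    change (equivTree l).numNodes + (equivTree r).numNodes + 1 + 1 = l.arity + r.arity
    omega

theorem card_arity_eq {n : ℕ} (hn : 1 ≤ n) :
    Nat.card {t : BTree // t.arity = n} = catalan (n - 1) := by
  rw [← BinaryTree.treesOfNumNodesEq_card_eq_catalan, ← Nat.card_eq_finsetCard]
  refine Nat.card_congr (equivTree.subtypeEquiv fun t => ?_)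
  rw [BinaryTree.mem_treesOfNumNodesEq, ← numNodes_equivTree]
  omega

end BTree

open BTree

theorem Step.arity_le {γ : ℕ} {t t' : BTree}
    (h : Step (fun s s' => s.arity = γ + 1 ∧ s' = rightComb γ) t t') :
    γ + 1 ≤ t.arity ∧ γ + 1 ≤ t'.arity := by
  obtain ⟨s, s', r, i, rs, ⟨hs, rfl⟩, hi, hir, -, rfl, rfl⟩ := h
  constructor
  · exact hs ▸ (arity_le_arity_multigraft s rs).trans (arity_le_arity_graft r _ hi hir)
  · exact arity_rightComb γ ▸
      (arity_le_arity_multigraft (rightComb γ) rs).trans (arity_le_arity_graft r _ hi hir)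

theorem Step.node_right {R : BTree → BTree → Prop} {t t' : BTree} (l : BTree)
    (h : Step R t t') : Step R (node l t) (node l t') := by
  obtain ⟨s, s', r, i, rs, hR, hi, hir, hrs, rfl, rfl⟩ := h
  refine ⟨s, s', node l r, l.arity + i, rs, hR, by omega, Nat.add_le_add_left hir _, hrs, ?_, ?_⟩ <;>
    simp [graft, show i ≠ 0 by omega]

theorem CongrGen.node_right {R : BTree → BTree → Prop} {t t' : BTree} (l : BTree)
    (h : CongrGen R t t') : CongrGen R (node l t) (node l t') := by
  induction h with
  | rel _ _ h => exact .rel _ _ (h.node_right l)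
  | refl _ => exact .refl _
  | symm _ _ _ ih => exact .symm _ _ ih
  | trans _ _ _ _ _ ih₁ ih₂ => exact .trans _ _ _ ih₁ ih₂

theorem CongrGen.multigraft {R : BTree → BTree → Prop} {s s' : BTree} (h : R s s')
    {rs : List BTree} (hrs : rs.length = s.arity) :
    CongrGen R (s.multigraft rs) (s'.multigraft rs) :=
  .rel _ _ ⟨s, s', leaf, 1, rs, h, le_rfl, le_rfl, hrs, rfl, rfl⟩

namespace RCCongr

variable {γ : ℕ}

theorem eq_or_lt_arity {t t' : BTree} (h : RCCongr γ t t') :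
    t = t' ∨ γ + 1 ≤ t.arity ∧ γ + 1 ≤ t'.arity := by
  induction h with
  | rel _ _ h => exact .inr h.arity_le
  | refl _ => exact .inl rfl
  | symm _ _ _ ih => exact ih.imp Eq.symm And.symm
  | trans _ _ _ _ _ ih₁ ih₂ =>
    rcases ih₁ with rfl | h₁
    · exact ih₂
    · rcases ih₂ with rfl | h₂
      · exact .inr h₁
      · exact .inr ⟨h₁.1, h₂.2⟩

theorem eq_of_arity_le {t t' : BTree} (ht : t.arity ≤ γ) (h : RCCongr γ t t') : t = t' :=
  h.eq_or_lt_arity.resolve_right fun h' => by omega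

theorem multigraft {s s' : BTree} (hs : s.arity = γ + 1) (hs' : s'.arity = γ + 1)
    {rs : List BTree} (hrs : rs.length = γ + 1) :
    RCCongr γ (s.multigraft rs) (s'.multigraft rs) :=
  .trans _ _ _ (CongrGen.multigraft ⟨hs, rfl⟩ (hrs.trans hs.symm))
    (.symm _ _ (CongrGen.multigraft ⟨hs', rfl⟩ (hrs.trans hs'.symm)))

theorem rotate (hγ : 2 ≤ γ) (a b c : BTree) (h : γ + 1 ≤ a.arity + b.arity + c.arity) :
    RCCongr γ (node (node a b) c) (node a (node b c)) := by
  have ha := one_le_arity a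
  have hb := one_le_arity b
  have hc := one_le_arity c
  obtain ⟨k₁, k₂, k₃, h₁, h₂, h₃, h₁', h₂', h₃', hk⟩ : ∃ k₁ k₂ k₃, 1 ≤ k₁ ∧ 1 ≤ k₂ ∧ 1 ≤ k₃ ∧
      k₁ ≤ a.arity ∧ k₂ ≤ b.arity ∧ k₃ ≤ c.arity ∧ k₁ + k₂ + k₃ = γ + 1 := by
    let k₁ := min a.arity (γ - 1)
    let k₂ := min b.arity (γ - k₁)
    exact ⟨k₁, k₂, γ + 1 - k₁ - k₂, by omega, by omega, by omega, by omega, by omega, by omega,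
      by omega⟩
  obtain ⟨s₁, rs₁, e₁, l₁, rfl⟩ := exists_eq_multigraft a h₁ h₁'
  obtain ⟨s₂, rs₂, e₂, l₂, rfl⟩ := exists_eq_multigraft b h₂ h₂'
  obtain ⟨s₃, rs₃, e₃, l₃, rfl⟩ := exists_eq_multigraft c h₃ h₃'
  have key : RCCongr γ ((node (node s₁ s₂) s₃).multigraft (rs₁ ++ rs₂ ++ rs₃))
      ((node s₁ (node s₂ s₃)).multigraft (rs₁ ++ (rs₂ ++ rs₃))) := by
    rw [← List.append_assoc]
    apply multigraft <;> simp only [arity, List.length_append] <;> omega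
  rwa [node_multigraft_append _ _ _ _ (by simp [arity, l₁, l₂]),
    node_multigraft_append _ _ _ _ l₁, node_multigraft_append _ _ _ _ l₁,
    node_multigraft_append _ _ _ _ l₂] at key

theorem of_arity_eq {t t' : BTree} (ht : t.arity = γ + 1) (ht' : t'.arity = γ + 1) :
    RCCongr γ t t' := by
  have h := multigraft ht ht' (List.length_replicate (n := γ + 1) (a := leaf))
  have e := multigraft_replicate_leaf t
  have e' := multigraft_replicate_leaf t'
  rw [ht] at e
  rw [ht'] at e'
  rwa [e, e'] at h

theorem rightComb_arity_sub_one (hγ : 2 ≤ γ) (t : BTree) (h : γ + 1 ≤ t.arity) :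
    RCCongr γ t (rightComb (t.arity - 1)) := by
  obtain h | h := h.eq_or_lt
  · exact of_arity_eq h.symm (by rw [arity_rightComb]; omega)
  match t with
  | leaf => simp [arity] at h
  | node leaf r =>
    simp only [arity] at h ⊢
    have ih := rightComb_arity_sub_one hγ r (by omega)
    obtain ⟨m, hm⟩ : ∃ m, r.arity = m + 1 := ⟨r.arity - 1, by omega⟩
    rw [hm] at ih ⊢
    rw [show 1 + (m + 1) - 1 = m + 1 by omega]
    exact ih.node_right leaf
  | node (node a b) r =>
    have ih := rightComb_arity_sub_one hγ (node a (node b r)) (by simp only [arity] at h ⊢; omega)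
    simp only [arity, ← Nat.add_assoc] at h ih ⊢
    exact .trans _ _ _ (rotate hγ a b r h.le) ih
termination_by (t.arity, (match t with | node l _ => l.arity | leaf => 0))
decreasing_by
  · simp only [arity, Prod.lex_def]; omega
  · have := one_le_arity b
    simp only [arity, Prod.lex_def]; omega

theorem of_arity_eq_arity (hγ : 2 ≤ γ) {t t' : BTree} (h : t.arity = t'.arity)
    (ht : γ + 1 ≤ t.arity) : RCCongr γ t t' :=
  .trans _ _ _ (rightComb_arity_sub_one hγ t ht)
    (h ▸ .symm _ _ (rightComb_arity_sub_one hγ t' (h ▸ ht)))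

end RCCongr

/-- The quotient of the magmatic operad by the congruence equating all trees of
arity `γ + 1` with the right comb `R_γ` is realized by the `γ`-right comb
operad: classes of trees of arity `n ≤ γ` are singletons, all trees of a common
arity `n ≥ γ + 1` are equivalent, and the numbers of classes are as announced. -/
theorem stmt7 (γ : ℕ) (hγ : 2 ≤ γ) :
    (∀ t t' : BTree, t.arity ≤ γ → RCCongr γ t t' → t = t') ∧
    (∀ t t' : BTree, t.arity = t'.arity → γ + 1 ≤ t.arity → RCCongr γ t t') ∧
    (∀ n : ℕ, 1 ≤ n → n ≤ γ → classCount (RCCongr γ) n = catalan (n - 1)) ∧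
    (∀ n : ℕ, γ + 1 ≤ n → classCount (RCCongr γ) n = 1) := by
  refine ⟨fun t t' ht h => h.eq_of_arity_le ht,
    fun t t' h ht => .of_arity_eq_arity hγ h ht, fun n hn hnγ => ?_, fun n hn => ?_⟩
  · rw [← card_arity_eq hn]
    refine (Nat.card_eq_of_bijective (Quot.mk _) ⟨fun a b hab => ?_, Quot.mk_surjective⟩).symm
    refine (Equivalence.eqvGen_iff eq_equivalence).1
      ((Quot.eqvGen_exact hab).mono fun x y hxy => ?_)
    exact Subtype.ext (RCCongr.eq_of_arity_le (x.2.trans_le hnγ) hxy)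
  · refine Nat.card_eq_one_iff_unique.2 ⟨⟨?_⟩, ⟨Quot.mk _ ⟨rightComb (n - 1), ?_⟩⟩⟩
    · rintro ⟨a⟩ ⟨b⟩
      exact Quot.sound (.of_arity_eq_arity hγ (a.2.trans b.2.symm) (a.2.symm ▸ hn))
    · rw [arity_rightComb]; omega
end
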